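/- arXiv:1310.7560 — 2 statements merged into one kernel-verified Lean document; each statement's English description precedes it below -/
import Mathlib

section
/- For every A ∈ (0,2), the operator 𝒢 is a compact self-adjoint bounded linear operator on L²((−π,π),ℂ) whose spectrum is exactly the three-point set {0, A/2, 1}. -/
open MeasureTheory Real Set

/-- The integral operator 𝒢 with coupling kernel `G(x) = (1/(2π))(1 + A cos x)`:
`(𝒢φ)(x) = ∫_{-π}^{π} G(x - y) φ(y) dy`. -/
noncomputable def Gop (A : ℝ) (φ : ℝ → ℂ) (x : ℝ) : ℂ :=
  ∫ y in (-π)..π, (((1 + A * Real.cos (x - y)) / (2 * π) : ℝ) : ℂ) * φ y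

/-- Lebesgue measure on the interval `(-π, π)`. -/
noncomputable def μπ : Measure ℝ := MeasureTheory.volume.restrict (Set.Ioo (-π) π)

/-- Eigenvalues of a continuous linear endomorphism belong to its spectrum. -/
theorem mem_spectrum_of_apply_eq_smul {E : Type*} [NormedAddCommGroup E] [NormedSpace ℂ E]
    {T : E →L[ℂ] E} {c : ℂ} {v : E} (hv : v ≠ 0) (h : T v = c • v) : c ∈ spectrum ℂ T := by
  rw [spectrum.mem_iff]
  intro hu
  obtain ⟨S, hS⟩ := hu.exists_left_inv
  apply hv
  have hz : (algebraMap ℂ (E →L[ℂ] E) c - T) v = 0 := by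
    simp [Algebra.algebraMap_eq_smul_one, h]
  simpa [hz] using (congrArg (fun R : E →L[ℂ] E => R v) hS).symm

theorem isCompactOperator_rankOne {E : Type*} [NormedAddCommGroup E] [InnerProductSpace ℂ E]
    (x y : E) : IsCompactOperator (InnerProductSpace.rankOne ℂ x y) := by
  rw [InnerProductSpace.rankOne_def']
  exact (isCompactOperator_of_locallyCompactSpace_rng
    (ContinuousLinearMap.toSpanSingleton ℂ x)).comp_clm (innerSL ℂ y)

/-- The spectrum of an operator `a u⊗u + b (v⊗v + w⊗w)` with orthogonal `u`, `v`, `w` and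
nontrivial kernel. -/
theorem spectrum_eq_of_orthogonal {H : Type*} [NormedAddCommGroup H] [InnerProductSpace ℂ H]
    {T : H →L[ℂ] H} {a b : ℝ} {α β : ℂ} {u v w z : H}
    (hT : ∀ x, T x = (a : ℂ) • inner ℂ u x • u +
      (b : ℂ) • (inner ℂ v x • v + inner ℂ w x • w))
    (huv : inner ℂ u v = 0) (huw : inner ℂ u w = 0) (hvw : inner ℂ v w = 0)
    (huz : inner ℂ u z = 0) (hvz : inner ℂ v z = 0) (hwz : inner ℂ w z = 0)
    (hu : a * inner ℂ u u = α) (hv : b * inner ℂ v v = β) (hw : b * inner ℂ w w = β)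
    (hu0 : u ≠ 0) (hv0 : v ≠ 0) (hz0 : z ≠ 0) :
    spectrum ℂ T = {0, β, α} := by
  have hvu : inner ℂ v u = 0 := inner_eq_zero_symm.1 huv
  have hwu : inner ℂ w u = 0 := inner_eq_zero_symm.1 huw
  have hwv : inner ℂ w v = 0 := inner_eq_zero_symm.1 hvw
  have hTu : T u = α • u := by rw [hT, hvu, hwu, smul_smul, hu]; simp
  have hTv : T v = β • v := by rw [hT, huv, hwv, ← hv]; simp [smul_smul]
  have hTw : T w = β • w := by rw [hT, huw, hvw, ← hw]; simp [smul_smul]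
  have hTz : T z = (0 : ℂ) • z := by rw [hT, huz, hvz, hwz]; simp
  apply Subset.antisymm
  · intro k hk
    let p : Polynomial ℂ :=
      (Polynomial.X - Polynomial.C α) * (Polynomial.X - Polynomial.C β) * Polynomial.X
    have hp : Polynomial.aeval T p = 0 := by
      ext x
      simp only [p, map_mul, map_sub, Polynomial.aeval_X, Polynomial.aeval_C,
        Algebra.algebraMap_eq_smul_one, mul_apply_eq_comp,
        sub_apply, smul_apply,
        one_apply_eq_self, zero_apply]
      rw [hT x]
      simp only [map_add, map_smul, hTu, hTv, hTw]
      module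
    have hmem := spectrum.subset_polynomial_aeval T p ⟨k, hk, rfl⟩
    have : Nontrivial H := ⟨u, 0, hu0⟩
    rw [hp, spectrum.zero_eq] at hmem
    simp only [p, Polynomial.eval_mul, Polynomial.eval_sub, Polynomial.eval_X, Polynomial.eval_C,
      mem_singleton_iff, mul_eq_zero, sub_eq_zero] at hmem
    simp only [mem_insert_iff, mem_singleton_iff]
    tauto
  · rintro k (rfl | rfl | rfl)
    · exact mem_spectrum_of_apply_eq_smul hz0 hTz
    · exact mem_spectrum_of_apply_eq_smul hv0 hTv
    · exact mem_spectrum_of_apply_eq_smul hu0 hTu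

instance : IsFiniteMeasure μπ := by
  unfold μπ
  infer_instance

theorem integral_μπ (f : ℝ → ℂ) : ∫ x, f x ∂μπ = ∫ x in (-π)..π, f x := by
  rw [intervalIntegral.integral_of_le (by linarith [pi_pos]), integral_Ioc_eq_integral_Ioo, μπ]

theorem memLp_ofReal_μπ {f : ℝ → ℝ} (hf : Continuous f) :
    MemLp (fun x => (f x : ℂ)) 2 μπ := by
  obtain ⟨C, hC⟩ := (isCompact_Icc (a := -π) (b := π)).exists_bound_of_continuousOn
    hf.continuousOn
  refine MemLp.of_bound (Complex.continuous_ofReal.comp hf).aestronglyMeasurable C ?_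
  unfold μπ
  filter_upwards [ae_restrict_mem measurableSet_Ioo] with x hx
  simpa using hC x (Ioo_subset_Icc_self hx)

/-- The class in `L²(-π, π)` of a continuous real function. -/
noncomputable def contLp (f : ℝ → ℝ) (hf : Continuous f) : Lp ℂ 2 μπ :=
  (memLp_ofReal_μπ hf).toLp _

theorem coeFn_contLp (f : ℝ → ℝ) (hf : Continuous f) :
    contLp f hf =ᵐ[μπ] fun x => (f x : ℂ) :=
  MemLp.coeFn_toLp _

theorem inner_contLp_left (f : ℝ → ℝ) (hf : Continuous f) (φ : Lp ℂ 2 μπ) :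
    inner ℂ (contLp f hf) φ = ∫ y in (-π)..π, (f y : ℂ) * φ y := by
  rw [L2.inner_def, ← integral_μπ]
  apply integral_congr_ae
  filter_upwards [coeFn_contLp f hf] with x hx
  simp [hx, mul_comm]

theorem inner_contLp_contLp (f g : ℝ → ℝ) (hf : Continuous f) (hg : Continuous g) :
    inner ℂ (contLp f hf) (contLp g hg) = ((∫ y in (-π)..π, f y * g y : ℝ) : ℂ) := by
  rw [inner_contLp_left, ← intervalIntegral.integral_ofReal, ← integral_μπ, ← integral_μπ]
  apply integral_congr_ae
  filter_upwards [coeFn_contLp g hg] with x hx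
  simp [hx]

theorem contLp_ne_zero {f : ℝ → ℝ} {hf : Continuous f}
    (h : ∫ y in (-π)..π, f y * f y ≠ 0) : contLp f hf ≠ 0 := by
  intro h0
  have := inner_contLp_contLp f f hf hf
  rw [h0, inner_zero_left] at this
  exact h (by exact_mod_cast this.symm)

theorem intervalIntegrable_ofReal_mul (f : ℝ → ℝ) (hf : Continuous f) (φ : Lp ℂ 2 μπ) :
    IntervalIntegrable (fun y => (f y : ℂ) * φ y) volume (-π) π := by
  rw [intervalIntegrable_iff_integrableOn_Ioo_of_le (by linarith [pi_pos])]
  exact (memLp_ofReal_μπ hf).integrable_mul (Lp.memLp φ)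

/-- The addition formula for the cosine splits the kernel of `Gop`. -/
theorem Gop_eq_inner (A : ℝ) (φ : Lp ℂ 2 μπ) (x : ℝ) :
    Gop A φ x = ((1 / (2 * π) : ℝ) : ℂ) * inner ℂ (contLp (fun _ => 1) continuous_const) φ +
      ((A / (2 * π) : ℝ) : ℂ) * (inner ℂ (contLp cos continuous_cos) φ * (cos x : ℂ) +
        inner ℂ (contLp sin continuous_sin) φ * (sin x : ℂ)) := by
  have h1 := intervalIntegrable_ofReal_mul (fun _ => 1) continuous_const φ
  have hc := intervalIntegrable_ofReal_mul cos continuous_cos φ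
  have hs := intervalIntegrable_ofReal_mul sin continuous_sin φ
  simp only [inner_contLp_left, Gop]
  rw [← intervalIntegral.integral_mul_const, ← intervalIntegral.integral_mul_const,
    ← intervalIntegral.integral_add (hc.mul_const _) (hs.mul_const _),
    ← intervalIntegral.integral_const_mul, ← intervalIntegral.integral_const_mul,
    ← intervalIntegral.integral_add (h1.const_mul _)
      (((hc.mul_const _).add (hs.mul_const _)).const_mul _)]
  congr 1
  ext y
  rw [cos_sub]
  push_cast
  ring

theorem apply_eq_of_ae_eq_Gop {A : ℝ} {T : Lp ℂ 2 μπ →L[ℂ] Lp ℂ 2 μπ}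
    (hT : ∀ φ : Lp ℂ 2 μπ, (T φ : ℝ → ℂ) =ᵐ[μπ] Gop A (φ : ℝ → ℂ)) (φ : Lp ℂ 2 μπ) :
    T φ = ((1 / (2 * π) : ℝ) : ℂ) • inner ℂ (contLp (fun _ => 1) continuous_const) φ •
        contLp (fun _ => 1) continuous_const +
      ((A / (2 * π) : ℝ) : ℂ) •
        (inner ℂ (contLp cos continuous_cos) φ • contLp cos continuous_cos +
          inner ℂ (contLp sin continuous_sin) φ • contLp sin continuous_sin) := by
  apply Lp.ext
  set u := contLp (fun _ => 1) continuous_const with hu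
  set v := contLp cos continuous_cos with hv
  set w := contLp sin continuous_sin with hw
  filter_upwards [hT φ, coeFn_contLp (fun _ => 1) continuous_const,
    coeFn_contLp cos continuous_cos, coeFn_contLp sin continuous_sin,
    Lp.coeFn_add (((1 / (2 * π) : ℝ) : ℂ) • inner ℂ u φ • u)
      (((A / (2 * π) : ℝ) : ℂ) • (inner ℂ v φ • v + inner ℂ w φ • w)),
    Lp.coeFn_smul ((1 / (2 * π) : ℝ) : ℂ) (inner ℂ u φ • u), Lp.coeFn_smul (inner ℂ u φ) u,
    Lp.coeFn_smul ((A / (2 * π) : ℝ) : ℂ) (inner ℂ v φ • v + inner ℂ w φ • w),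
    Lp.coeFn_add (inner ℂ v φ • v) (inner ℂ w φ • w),
    Lp.coeFn_smul (inner ℂ v φ) v, Lp.coeFn_smul (inner ℂ w φ) w]
    with x h0 h1 h2 h3 h4 h5 h6 h7 h8 h9 h10
  rw [← hu] at h1
  rw [← hv] at h2
  rw [← hw] at h3
  rw [h0, h4, Pi.add_apply, h5, h7, Pi.smul_apply, Pi.smul_apply, h6, h8, Pi.add_apply, h9, h10,
    Pi.smul_apply, Pi.smul_apply, Pi.smul_apply, h1, h2, h3, Gop_eq_inner]
  simp [hu, hv, hw]

theorem integral_sin_mul_cos_mul_self :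
    ∫ x in (-π)..π, (sin x * cos x) * (sin x * cos x) = π / 4 := by
  simp_rw [show ∀ x, (sin x * cos x) * (sin x * cos x) = sin x ^ 2 * cos x ^ 2 by intro x; ring]
  rw [integral_sin_sq_mul_cos_sq]
  have h : sin (4 * π) = 0 := by simpa using sin_nat_mul_pi 4
  simp [h]
  ring

/-- For `A ∈ (0,2)`, the bounded linear operator on `L²((-π,π),ℂ)`
induced by `𝒢` is compact and self-adjoint, and its spectrum is exactly `{0, A/2, 1}`. -/
theorem stmt2 (A : ℝ) (hA : A ∈ Set.Ioo (0 : ℝ) 2)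
    (T : Lp ℂ 2 μπ →L[ℂ] Lp ℂ 2 μπ)
    (hT : ∀ φ : Lp ℂ 2 μπ, (T φ : ℝ → ℂ) =ᵐ[μπ] Gop A (φ : ℝ → ℂ)) :
    IsCompactOperator T ∧ IsSelfAdjoint T ∧
      spectrum ℂ T = ({0, ((A / 2 : ℝ) : ℂ), 1} : Set ℂ) := by
  have hT' := apply_eq_of_ae_eq_Gop hT
  set u := contLp (fun _ => 1) continuous_const with hu
  set v := contLp cos continuous_cos with hv
  set w := contLp sin continuous_sin with hw
  have hpi : (π : ℂ) ≠ 0 := by exact_mod_cast pi_ne_zero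
  have hTr : T = ((1 / (2 * π) : ℝ) : ℂ) • InnerProductSpace.rankOne ℂ u u +
      ((A / (2 * π) : ℝ) : ℂ) •
        (InnerProductSpace.rankOne ℂ v v + InnerProductSpace.rankOne ℂ w w) := by
    ext1 φ
    rw [hT' φ]
    rfl
  refine ⟨?_, ?_, ?_⟩
  · rw [hTr]
    exact ((isCompactOperator_rankOne u u).smul _).add
      (((isCompactOperator_rankOne v v).add (isCompactOperator_rankOne w w)).smul _)
  · have hr (x : Lp ℂ 2 μπ) : IsSelfAdjoint (InnerProductSpace.rankOne ℂ x x) :=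
      InnerProductSpace.adjoint_rankOne x x
    have hc (r : ℝ) : IsSelfAdjoint (r : ℂ) := Complex.conj_ofReal r
    rw [hTr]
    exact ((hc _).smul (hr u)).add ((hc _).smul ((hr v).add (hr w)))
  · have huu : ∫ x in (-π)..π, (1 : ℝ) * 1 = 2 * π := by simp; ring
    have hvv : ∫ x in (-π)..π, cos x * cos x = π := by
      simp_rw [← sq]
      simp
    have hww : ∫ x in (-π)..π, sin x * sin x = π := by
      simp_rw [← sq]
      simp
    have hvz : ∫ x in (-π)..π, cos x * (sin x * cos x) = 0 := by
      simp_rw [show ∀ x, cos x * (sin x * cos x) = sin x * cos x ^ 2 by intro x; ring]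
      simp
    have hwz : ∫ x in (-π)..π, sin x * (sin x * cos x) = 0 := by
      simp_rw [show ∀ x, sin x * (sin x * cos x) = sin x ^ 2 * cos x by intro x; ring]
      simp
    have hvw : ∫ x in (-π)..π, cos x * sin x = 0 := by
      simp_rw [mul_comm (cos _)]
      simp
    refine spectrum_eq_of_orthogonal (z := contLp (fun x => sin x * cos x)
      (continuous_sin.mul continuous_cos)) hT' ?_ ?_ ?_ ?_ ?_ ?_ ?_ ?_ ?_
      (contLp_ne_zero ?_) (contLp_ne_zero ?_) (contLp_ne_zero ?_)
    · simp [hu, hv, inner_contLp_contLp]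
    · simp [hu, hw, inner_contLp_contLp]
    · simp [hv, hw, inner_contLp_contLp, hvw]
    · simp [hu, inner_contLp_contLp]
    · simp [hv, inner_contLp_contLp, hvz]
    · simp [hw, inner_contLp_contLp, hwz]
    · rw [hu, inner_contLp_contLp, huu]
      push_cast
      field_simp
    · rw [hv, inner_contLp_contLp, hvv]
      push_cast
      field_simp
    · rw [hw, inner_contLp_contLp, hww]
      push_cast
      field_simp
    · rw [huu]
      positivity
    · rw [hvv]
      positivity
    · rw [integral_sin_mul_cos_mul_self]
      positivity
end

section
/- Let η : [−π,π] → ℂ be continuous, let a : [−π,π] → ℂ be continuous, let α_*, K ∈ ℝ, r_* > 0, and let 𝒦 and 𝒞 be the ℝ-linear operators on L²((−π,π),ℂ) given by (𝒦v)(x) = (1/2)e^{−iα_*}(𝒢v)(x) − (1/2)e^{iα_*}a(x)²(𝒢v̄)(x) and (𝒞v)(x) = (iK a(x)η(x)/(4π² r_*)) Re(∫ ā dy ∫ v dy). Let V be the finite-dimensional real subspace of L²((−π,π),ℂ) spanned (over ℝ) by the functions 1, i, cos x, i cos x, sin x, i sin x, a², i a², a² cos x, i a² cos x, a² sin x, i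 a² sin x, and i a η. Then for every λ ∈ ℂ with λ ∉ η([−π,π]), the equation λ v = η v + 𝒦v + 𝒞v has a nonzero solution v ∈ L²((−π,π),ℂ) if and only if the ℝ-linear map w ↦ (𝒦 + 𝒞)((λ − η)^{−1} w), which maps V into V, has a nonzero fixed point in V; i.e. the point spectrum of ℒ off the essential spectrum is determined by a finite-dimensional eigenvalue problem. -/
open MeasureTheory Real Set

instance isFiniteMeasure_μπ : IsFiniteMeasure μπ := by
  unfold μπ
  infer_instance

theorem integrable_μπ_iff_intervalIntegrable {φ : ℝ → ℂ} :
    Integrable φ μπ ↔ IntervalIntegrable φ volume (-π) π := by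
  rw [intervalIntegrable_iff_integrableOn_Ioo_of_le (by linarith [Real.pi_pos])]
  rfl

/-- The range of `𝒢` lies in the span of `1, cos, sin`. -/
theorem exists_Gop_eq_trig (A : ℝ) {φ : ℝ → ℂ} (hφ : Integrable φ μπ) :
    ∃ p q r : ℂ, ∀ x, Gop A φ x = p + q * (Real.cos x : ℂ) + r * (Real.sin x : ℂ) := by
  rw [integrable_μπ_iff_intervalIntegrable] at hφ
  have hc : IntervalIntegrable (fun y => (Real.cos y : ℂ) * φ y) volume (-π) π :=
    hφ.continuousOn_mul (by fun_prop)
  have hs : IntervalIntegrable (fun y => (Real.sin y : ℂ) * φ y) volume (-π) π :=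
    hφ.continuousOn_mul (by fun_prop)
  refine ⟨(1 / (2 * π) : ℂ) * ∫ y in (-π)..π, φ y,
    (A / (2 * π) : ℂ) * ∫ y in (-π)..π, (Real.cos y : ℂ) * φ y,
    (A / (2 * π) : ℂ) * ∫ y in (-π)..π, (Real.sin y : ℂ) * φ y, fun x => ?_⟩
  have h : ∀ y, (((1 + A * Real.cos (x - y)) / (2 * π) : ℝ) : ℂ) * φ y =
      (1 / (2 * π) : ℂ) * φ y + (A / (2 * π) * Real.cos x : ℂ) * ((Real.cos y : ℂ) * φ y)
        + (A / (2 * π) * Real.sin x : ℂ) * ((Real.sin y : ℂ) * φ y) := by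
    intro y
    rw [Real.cos_sub]
    push_cast
    ring
  simp only [Gop, h]
  rw [intervalIntegral.integral_add ((hφ.const_mul _).add (hc.const_mul _)) (hs.const_mul _),
    intervalIntegral.integral_add (hφ.const_mul _) (hc.const_mul _)]
  simp only [intervalIntegral.integral_const_mul]
  ring

theorem Lp_integrable_μπ (v : Lp ℂ 2 μπ) : Integrable (v : ℝ → ℂ) μπ :=
  (Lp.memLp v).integrable (by norm_num)

theorem integrable_conj_μπ {φ : ℝ → ℂ} (hφ : Integrable φ μπ) :
    Integrable (fun y => starRingEnd ℂ (φ y)) μπ :=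
  (Complex.conjCLE : ℂ →L[ℝ] ℂ).integrable_comp hφ

/-- A real subspace containing `g` and `I * g` contains every complex multiple of `g`. -/
theorem complex_smul_mem {μ : Measure ℝ} {V : Submodule ℝ (Lp ℂ 2 μ)} {g g' : Lp ℂ 2 μ}
    (hg : g ∈ V) (hg' : g' ∈ V)
    (h : (g' : ℝ → ℂ) =ᵐ[μ] fun x => Complex.I * (g : ℝ → ℂ) x) (z : ℂ) : z • g ∈ V := by
  have hz : z • g = z.re • g + z.im • g' := by
    apply Lp.ext
    filter_upwards [h, Lp.coeFn_smul z g, Lp.coeFn_smul z.re g, Lp.coeFn_smul z.im g',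
      Lp.coeFn_add (z.re • g) (z.im • g')] with x h₀ h₁ h₂ h₃ h₄
    simp only [h₁, h₂, h₃, h₄, Pi.smul_apply, Pi.add_apply, h₀, smul_eq_mul, Complex.real_smul]
    nth_rewrite 1 [← Complex.re_add_im z]
    ring
  rw [hz]
  exact V.add_mem (V.smul_mem _ hg) (V.smul_mem _ hg')

/-- For the linearized operator `ℒv = ηv + 𝒦v + 𝒞v` and `λ` off the essential
spectrum `η([-π,π])`, the eigenvalue problem `λv = ηv + 𝒦v + 𝒞v` has a nonzero solution in
`L²((-π,π),ℂ)` iff the ℝ-linear map `w ↦ (𝒦+𝒞)((λ-η)⁻¹w)`, which maps the finite-dimensional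
real subspace `V` spanned by `1, i, cos, i cos, sin, i sin, a², ia², a²cos, ia²cos, a²sin,
ia²sin, iaη` into itself, has a nonzero fixed point in `V`. -/
theorem stmt14 (A αs K rs : ℝ) (hrpos : 0 < rs) (a η : ℝ → ℂ)
    (ha : ContinuousOn a (Set.Icc (-π) π)) (hη : ContinuousOn η (Set.Icc (-π) π))
    (lam : ℂ) (hlam : lam ∉ η '' Set.Icc (-π) π)
    (M : Lp ℂ 2 μπ →L[ℂ] Lp ℂ 2 μπ)
    (hM : ∀ f : Lp ℂ 2 μπ, (M f : ℝ → ℂ) =ᵐ[μπ] fun x => η x * (f : ℝ → ℂ) x)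
    (R : Lp ℂ 2 μπ →L[ℂ] Lp ℂ 2 μπ)
    (hR : ∀ w : Lp ℂ 2 μπ, (R w : ℝ → ℂ) =ᵐ[μπ] fun x => (lam - η x)⁻¹ * (w : ℝ → ℂ) x)
    (Kop : Lp ℂ 2 μπ →L[ℝ] Lp ℂ 2 μπ)
    (hKop : ∀ v : Lp ℂ 2 μπ,
      (Kop v : ℝ → ℂ) =ᵐ[μπ] fun x =>
        (1 / 2 : ℂ) * Complex.exp (-(Complex.I * (αs : ℂ))) * Gop A (v : ℝ → ℂ) x
          - (1 / 2 : ℂ) * Complex.exp (Complex.I * (αs : ℂ)) * (a x) ^ 2 *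
              Gop A (fun y => starRingEnd ℂ ((v : ℝ → ℂ) y)) x)
    (Cop : Lp ℂ 2 μπ →L[ℝ] Lp ℂ 2 μπ)
    (hCop : ∀ v : Lp ℂ 2 μπ,
      (Cop v : ℝ → ℂ) =ᵐ[μπ] fun x =>
        (Complex.I * (K : ℂ) * a x * η x / ((4 * π ^ 2 * rs : ℝ) : ℂ)) *
          ((Complex.re ((∫ y in (-π)..π, starRingEnd ℂ (a y)) *
            (∫ y in (-π)..π, (v : ℝ → ℂ) y)) : ℝ) : ℂ))
    (g₁ g₂ g₃ g₄ g₅ g₆ g₇ g₈ g₉ g₁₀ g₁₁ g₁₂ g₁₃ : Lp ℂ 2 μπ)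
    (hg₁ : (g₁ : ℝ → ℂ) =ᵐ[μπ] fun _ => (1 : ℂ))
    (hg₂ : (g₂ : ℝ → ℂ) =ᵐ[μπ] fun _ => Complex.I)
    (hg₃ : (g₃ : ℝ → ℂ) =ᵐ[μπ] fun x => (Real.cos x : ℂ))
    (hg₄ : (g₄ : ℝ → ℂ) =ᵐ[μπ] fun x => Complex.I * (Real.cos x : ℂ))
    (hg₅ : (g₅ : ℝ → ℂ) =ᵐ[μπ] fun x => (Real.sin x : ℂ))
    (hg₆ : (g₆ : ℝ → ℂ) =ᵐ[μπ] fun x => Complex.I * (Real.sin x : ℂ))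
    (hg₇ : (g₇ : ℝ → ℂ) =ᵐ[μπ] fun x => (a x) ^ 2)
    (hg₈ : (g₈ : ℝ → ℂ) =ᵐ[μπ] fun x => Complex.I * (a x) ^ 2)
    (hg₉ : (g₉ : ℝ → ℂ) =ᵐ[μπ] fun x => (a x) ^ 2 * (Real.cos x : ℂ))
    (hg₁₀ : (g₁₀ : ℝ → ℂ) =ᵐ[μπ] fun x => Complex.I * (a x) ^ 2 * (Real.cos x : ℂ))
    (hg₁₁ : (g₁₁ : ℝ → ℂ) =ᵐ[μπ] fun x => (a x) ^ 2 * (Real.sin x : ℂ))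
    (hg₁₂ : (g₁₂ : ℝ → ℂ) =ᵐ[μπ] fun x => Complex.I * (a x) ^ 2 * (Real.sin x : ℂ))
    (hg₁₃ : (g₁₃ : ℝ → ℂ) =ᵐ[μπ] fun x => Complex.I * a x * η x)
    (V : Submodule ℝ (Lp ℂ 2 μπ))
    (hV : V = Submodule.span ℝ
      ({g₁, g₂, g₃, g₄, g₅, g₆, g₇, g₈, g₉, g₁₀, g₁₁, g₁₂, g₁₃} : Set (Lp ℂ 2 μπ))) :
    (∀ w ∈ V, Kop (R w) + Cop (R w) ∈ V) ∧
    ((∃ v : Lp ℂ 2 μπ, v ≠ 0 ∧ lam • v = M v + Kop v + Cop v) ↔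
      (∃ w ∈ V, w ≠ 0 ∧ Kop (R w) + Cop (R w) = w)) := by
  have hne : ∀ᵐ x ∂μπ, lam - η x ≠ 0 := by
    refine (ae_restrict_iff' measurableSet_Ioo).2 (Filter.Eventually.of_forall fun x hx h => ?_)
    exact hlam ⟨x, Ioo_subset_Icc_self hx, (sub_eq_zero.1 h).symm⟩
  have hRleft : ∀ v, R (lam • v - M v) = v := by
    intro v
    apply Lp.ext
    filter_upwards [hne, hR (lam • v - M v), Lp.coeFn_sub (lam • v) (M v), Lp.coeFn_smul lam v,
      hM v] with x h₀ h₁ h₂ h₃ h₄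
    simp only [h₁, h₂, h₃, h₄, Pi.sub_apply, Pi.smul_apply, smul_eq_mul]
    field_simp
  have hRright : ∀ w, lam • R w - M (R w) = w := by
    intro w
    apply Lp.ext
    filter_upwards [hne, hR w, Lp.coeFn_sub (lam • R w) (M (R w)), Lp.coeFn_smul lam (R w),
      hM (R w)] with x h₀ h₁ h₂ h₃ h₄
    simp only [h₁, h₂, h₃, h₄, Pi.sub_apply, Pi.smul_apply, smul_eq_mul]
    field_simp
  have hK : ∀ v, Kop v ∈ V := by
    intro v
    obtain ⟨p, q, r, hG⟩ := exists_Gop_eq_trig A (Lp_integrable_μπ v)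
    obtain ⟨p', q', r', hG'⟩ := exists_Gop_eq_trig A (integrable_conj_μπ (Lp_integrable_μπ v))
    set c : ℂ := (1 / 2 : ℂ) * Complex.exp (-(Complex.I * (αs : ℂ)))
    set d : ℂ := -((1 / 2 : ℂ) * Complex.exp (Complex.I * (αs : ℂ))) with hd
    have hsum : Kop v = (c * p) • g₁ + ((c * q) • g₃ + ((c * r) • g₅ +
        ((d * p') • g₇ + ((d * q') • g₉ + (d * r') • g₁₁)))) := by
      apply Lp.ext
      refine (hKop v).trans ?_
      filter_upwards [hg₁, hg₃, hg₅, hg₇, hg₉, hg₁₁, Lp.coeFn_smul (c * p) g₁,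
        Lp.coeFn_smul (c * q) g₃, Lp.coeFn_smul (c * r) g₅, Lp.coeFn_smul (d * p') g₇,
        Lp.coeFn_smul (d * q') g₉, Lp.coeFn_smul (d * r') g₁₁,
        Lp.coeFn_add ((c * p) • g₁) ((c * q) • g₃ + ((c * r) • g₅ +
          ((d * p') • g₇ + ((d * q') • g₉ + (d * r') • g₁₁)))),
        Lp.coeFn_add ((c * q) • g₃) ((c * r) • g₅ +
          ((d * p') • g₇ + ((d * q') • g₉ + (d * r') • g₁₁))),
        Lp.coeFn_add ((c * r) • g₅) ((d * p') • g₇ + ((d * q') • g₉ + (d * r') • g₁₁)),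
        Lp.coeFn_add ((d * p') • g₇) ((d * q') • g₉ + (d * r') • g₁₁),
        Lp.coeFn_add ((d * q') • g₉) ((d * r') • g₁₁)]
        with x h₁ h₃ h₅ h₇ h₉ h₁₁ s₁ s₃ s₅ s₇ s₉ s₁₁ t₁ t₂ t₃ t₄ t₅
      simp only [t₁, t₂, t₃, t₄, t₅, s₁, s₃, s₅, s₇, s₉, s₁₁, Pi.add_apply, Pi.smul_apply,
        h₁, h₃, h₅, h₇, h₉, h₁₁, smul_eq_mul, hG, hG']
      rw [hd]
      ring
    have hmem : ∀ g ∈ ({g₁, g₂, g₃, g₄, g₅, g₆, g₇, g₈, g₉, g₁₀, g₁₁, g₁₂, g₁₃} :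
        Set (Lp ℂ 2 μπ)), g ∈ V := fun g hg => hV ▸ Submodule.subset_span hg
    rw [hsum]
    refine V.add_mem ?_ (V.add_mem ?_ (V.add_mem ?_ (V.add_mem ?_ (V.add_mem ?_ ?_))))
    · refine complex_smul_mem (hmem g₁ (by simp)) (hmem g₂ (by simp)) ?_ _
      filter_upwards [hg₁, hg₂] with x h h'
      simp [h, h']
    · refine complex_smul_mem (hmem g₃ (by simp)) (hmem g₄ (by simp)) ?_ _
      filter_upwards [hg₃, hg₄] with x h h'
      rw [h, h']
    · refine complex_smul_mem (hmem g₅ (by simp)) (hmem g₆ (by simp)) ?_ _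
      filter_upwards [hg₅, hg₆] with x h h'
      rw [h, h']
    · refine complex_smul_mem (hmem g₇ (by simp)) (hmem g₈ (by simp)) ?_ _
      filter_upwards [hg₇, hg₈] with x h h'
      rw [h, h']
    · refine complex_smul_mem (hmem g₉ (by simp)) (hmem g₁₀ (by simp)) ?_ _
      filter_upwards [hg₉, hg₁₀] with x h h'
      rw [h, h', mul_assoc]
    · refine complex_smul_mem (hmem g₁₁ (by simp)) (hmem g₁₂ (by simp)) ?_ _
      filter_upwards [hg₁₁, hg₁₂] with x h h'
      rw [h, h', mul_assoc]
  have hC : ∀ v, Cop v ∈ V := by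
    intro v
    set t : ℝ := Complex.re ((∫ y in (-π)..π, starRingEnd ℂ (a y)) *
      (∫ y in (-π)..π, (v : ℝ → ℂ) y)) with ht
    have hsmul : Cop v = (K / (4 * π ^ 2 * rs) * t) • g₁₃ := by
      apply Lp.ext
      refine (hCop v).trans ?_
      filter_upwards [hg₁₃, Lp.coeFn_smul (K / (4 * π ^ 2 * rs) * t) g₁₃] with x h₁ h₂
      simp only [h₂, Pi.smul_apply, h₁, Complex.real_smul, ← ht]
      push_cast
      ring
    rw [hsmul, hV]
    exact Submodule.smul_mem _ _ (Submodule.subset_span (by simp))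
  refine ⟨fun w _ => V.add_mem (hK _) (hC _), ?_, ?_⟩
  · rintro ⟨v, hv, h⟩
    have hw : Kop v + Cop v = lam • v - M v := by
      rw [h]
      abel
    have hRw : R (Kop v + Cop v) = v := by rw [hw, hRleft]
    refine ⟨Kop v + Cop v, V.add_mem (hK v) (hC v), fun h₀ => hv ?_, by rw [hRw]⟩
    rw [← hRw, h₀, map_zero]
  · rintro ⟨w, -, hw, h⟩
    refine ⟨R w, fun h₀ => hw ?_, ?_⟩
    · rw [← hRright w, h₀]
      simp
    · rw [add_assoc, h, ← sub_eq_iff_eq_add']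
      exact hRright w
end
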